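/- Let 0 < δ' < 1 be fixed and for D ≥ 2 and y ∈ ℝ set G(y, D) = Σ_{D < t ≤ D(1+δ')} t^{−2πiy}, the sum over integers t. Then for every ε > 0 and every parameter T > 1, G(y, D) ≪_{ε,δ'} (D·log D)/T·(T + |y|)^ε + D/(1 + |y|) + D^{1/2}(T + |y|)^{1/4 + ε}. -/

import Mathlib

open scoped Classical

noncomputable section

/-- The Dirichlet polynomial `G(y, D) = Σ_{D < t ≤ D(1+δ')} t^{-2πiy}`, summed over
integers `t`. -/
def Gpoly (δ' : ℝ) (y D : ℝ) : ℂ :=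
  ∑' t : ℤ,
    if D < (t : ℝ) ∧ (t : ℝ) ≤ D * (1 + δ') then
      ((t : ℂ)) ^ (-(2 * (Real.pi : ℂ) * Complex.I * (y : ℂ)))
    else 0

end

/-- Splitting of `1 / (1 - e(x))` into its constant real part and its imaginary part. -/
lemma one_sub_exp_mul_half_add_cot {x : ℝ} (hx : Real.sin (Real.pi * x) ≠ 0) :
    (1 - Complex.exp (2 * Real.pi * Complex.I * x)) *
      (1 / 2 + Complex.I / 2 * (Real.cos (Real.pi * x) / Real.sin (Real.pi * x) : ℝ)) = 1 := by
  have hexp : Complex.exp (2 * Real.pi * Complex.I * x) =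
      ((Real.cos (Real.pi * x) : ℂ) + (Real.sin (Real.pi * x) : ℂ) * Complex.I) ^ 2 := by
    rw [Complex.ofReal_cos, Complex.ofReal_sin, ← Complex.exp_mul_I, ← Complex.exp_nat_mul]
    congr 1
    push_cast
    ring
  have hcs : (Real.sin (Real.pi * x) : ℂ) ^ 2 + (Real.cos (Real.pi * x) : ℂ) ^ 2 = 1 := by
    exact_mod_cast Real.sin_sq_add_cos_sq (Real.pi * x)
  have hs : (Real.sin (Real.pi * x) : ℂ) ≠ 0 := by exact_mod_cast hx
  rw [hexp]
  push_cast [-Complex.ofReal_cos, -Complex.ofReal_sin]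
  generalize (Real.sin (Real.pi * x) : ℂ) = s at *
  generalize (Real.cos (Real.pi * x) : ℂ) = c at *
  have hI := Complex.I_sq
  field_simp
  linear_combination (s - c * Complex.I) * hcs +
    (-2 * s * c ^ 2 - s ^ 3 - c * s ^ 2 * Complex.I) * hI

lemma two_mul_le_sin_pi_mul {η x : ℝ} (hη : 0 ≤ η) (h1 : η ≤ x) (h2 : x ≤ 1 - η) :
    2 * η ≤ Real.sin (Real.pi * x) := by
  have hpi := Real.pi_pos
  have key : ∀ u : ℝ, η ≤ u → u ≤ 1 / 2 → 2 * η ≤ Real.sin (Real.pi * u) := by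
    intro u hu hu2
    have h := Real.mul_le_sin (x := Real.pi * u) (by nlinarith) (by nlinarith)
    have h' : 2 / Real.pi * (Real.pi * u) = 2 * u := by field_simp
    linarith
  rcases le_total x (1 / 2) with h | h
  · exact key x h1 h
  · have := key (1 - x) (by linarith) (by linarith)
    rwa [show Real.pi * (1 - x) = Real.pi - Real.pi * x by ring, Real.sin_pi_sub] at this

lemma abs_cos_div_sin_le {η x : ℝ} (hη : 0 < η) (h1 : η ≤ x) (h2 : x ≤ 1 - η) :
    |Real.cos (Real.pi * x) / Real.sin (Real.pi * x)| ≤ 1 / (2 * η) := by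
  have hs := two_mul_le_sin_pi_mul hη.le h1 h2
  rw [abs_div, abs_of_pos (show 0 < Real.sin (Real.pi * x) by linarith)]
  exact div_le_div₀ zero_le_one (Real.abs_cos_le_one _) (by positivity) hs

lemma cos_div_sin_anti {u v : ℝ} (hu : 0 < u) (huv : u ≤ v) (hv : v < 1) :
    Real.cos (Real.pi * v) / Real.sin (Real.pi * v) ≤
      Real.cos (Real.pi * u) / Real.sin (Real.pi * u) := by
  have hpi := Real.pi_pos
  have hsu : 0 < Real.sin (Real.pi * u) :=
    Real.sin_pos_of_pos_of_lt_pi (by positivity) (by nlinarith)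
  have hsv : 0 < Real.sin (Real.pi * v) :=
    Real.sin_pos_of_pos_of_lt_pi (mul_pos hpi (by linarith)) (by nlinarith)
  have h := Real.sin_nonneg_of_nonneg_of_le_pi (x := Real.pi * v - Real.pi * u)
    (by nlinarith) (by nlinarith)
  rw [Real.sin_sub] at h
  rw [div_le_div_iff₀ hsv hsu]
  linarith

/-- **Kusmin–Landau inequality** for a sequence of unimodular numbers with monotone phase
increments that stay away from the integers. -/
lemma norm_sum_Icc_le_of_phase_increment {z : ℕ → ℂ} {φ : ℕ → ℝ} {η : ℝ} {a b : ℕ}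
    (hη : 0 < η) (hab : a ≤ b) (hz : ∀ n, ‖z n‖ ≤ 1)
    (hrec : ∀ n ∈ Finset.Icc a b,
      z (n + 1) = z n * Complex.exp (2 * Real.pi * Complex.I * φ n))
    (hmono : MonotoneOn φ (Set.Icc a b))
    (hφ : ∀ n ∈ Finset.Icc a b, η ≤ φ n ∧ φ n ≤ 1 - η) :
    ‖∑ n ∈ Finset.Icc a b, z n‖ ≤ 2 / η := by
  set t : ℕ → ℝ := fun n => Real.cos (Real.pi * φ n) / Real.sin (Real.pi * φ n) with ht
  set c : ℕ → ℂ := fun n => 1 / 2 + Complex.I / 2 * (t n : ℝ) with hc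
  have hzc : ∀ n ∈ Finset.Icc a b, z n = (z n - z (n + 1)) * c n := by
    intro n hn
    have hs := two_mul_le_sin_pi_mul hη.le (hφ n hn).1 (hφ n hn).2
    have := one_sub_exp_mul_half_add_cot (x := φ n) (by linarith)
    rw [hrec n hn]
    linear_combination (-z n) * this
  have hη2 : η ≤ 1 / 2 := by
    have := hφ a (Finset.mem_Icc.2 ⟨le_rfl, hab⟩)
    linarith
  have ht_le : ∀ n ∈ Finset.Icc a b, |t n| ≤ 1 / (2 * η) := fun n hn =>
    abs_cos_div_sin_le hη (hφ n hn).1 (hφ n hn).2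
  have hc_le : ∀ n ∈ Finset.Icc a b, ‖c n‖ ≤ 1 / 2 + 1 / 2 * (1 / (2 * η)) := by
    intro n hn
    refine (norm_add_le _ _).trans ?_
    rw [norm_mul, Complex.norm_real, Real.norm_eq_abs]
    have := ht_le n hn
    norm_num at this ⊢
    linarith
  have main : ∀ m, a ≤ m → m ≤ b →
      ‖∑ n ∈ Finset.Icc a m, z n + z (m + 1) * c m‖ ≤ ‖c a‖ + 1 / 2 * (t a - t m) := by
    intro m ham
    induction m, ham using Nat.le_induction with
    | base =>
      intro _
      have h := hzc a (Finset.mem_Icc.2 ⟨le_rfl, hab⟩)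
      have h' : z a + z (a + 1) * c a = z a * c a := by linear_combination h
      rw [Finset.Icc_self, Finset.sum_singleton, h', norm_mul, sub_self, mul_zero, add_zero]
      exact mul_le_of_le_one_left (norm_nonneg _) (hz a)
    | succ m ham ih =>
      intro hmb
      have hm : m ∈ Finset.Icc a b := Finset.mem_Icc.2 ⟨ham, by omega⟩
      have hm1 : m + 1 ∈ Finset.Icc a b := Finset.mem_Icc.2 ⟨by omega, hmb⟩
      have h := hzc (m + 1) hm1
      rw [Finset.sum_Icc_succ_top (by omega)]
      have h' : ∑ n ∈ Finset.Icc a m, z n + z (m + 1) + z (m + 1 + 1) * c (m + 1) =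
          (∑ n ∈ Finset.Icc a m, z n + z (m + 1) * c m) + z (m + 1) * (c (m + 1) - c m) := by
        linear_combination h
      have hle : t (m + 1) ≤ t m :=
        cos_div_sin_anti (by linarith [(hφ m hm).1])
          (hmono (Finset.mem_Icc.1 hm) (Finset.mem_Icc.1 hm1) (by omega))
          (by linarith [(hφ (m + 1) hm1).2])
      have hd : ‖c (m + 1) - c m‖ = 1 / 2 * (t m - t (m + 1)) := by
        have : c (m + 1) - c m = Complex.I / 2 * ((t (m + 1) - t m : ℝ) : ℂ) := by
          simp only [hc]
          push_cast
          ring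
        rw [this, norm_mul, Complex.norm_real, Real.norm_eq_abs, abs_of_nonpos (by linarith)]
        norm_num
      rw [h']
      refine (norm_add_le _ _).trans ?_
      rw [norm_mul, hd]
      have h1 := ih (by omega)
      have h2 : ‖z (m + 1)‖ * (1 / 2 * (t m - t (m + 1))) ≤ 1 / 2 * (t m - t (m + 1)) :=
        mul_le_of_le_one_left (by linarith) (hz _)
      linarith
  have ha : a ∈ Finset.Icc a b := Finset.mem_Icc.2 ⟨le_rfl, hab⟩
  have hb : b ∈ Finset.Icc a b := Finset.mem_Icc.2 ⟨hab, le_rfl⟩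
  have h1 := main b hab le_rfl
  have h2 : ‖∑ n ∈ Finset.Icc a b, z n‖ ≤
      ‖∑ n ∈ Finset.Icc a b, z n + z (b + 1) * c b‖ + ‖z (b + 1) * c b‖ := by
    simpa using norm_sub_le (∑ n ∈ Finset.Icc a b, z n + z (b + 1) * c b) (z (b + 1) * c b)
  have h3 : ‖z (b + 1) * c b‖ ≤ ‖c b‖ := by
    rw [norm_mul]
    exact mul_le_of_le_one_left (norm_nonneg _) (hz _)
  have h4 := hc_le a ha
  have h5 := hc_le b hb
  have h6 := (abs_le.1 (ht_le a ha)).2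
  have h7 := (abs_le.1 (ht_le b hb)).1
  have h8 : (1 : ℝ) ≤ 1 / (2 * η) := by
    rw [le_div_iff₀ (by positivity)]
    linarith
  have h9 : 2 / η = 4 * (1 / (2 * η)) := by
    field_simp
    norm_num
  rw [h9]
  linarith

lemma Finset.eq_Icc_min'_max' {s : Finset ℕ} (hs : s.Nonempty)
    (hconv : (s : Set ℕ).OrdConnected) : s = Finset.Icc (s.min' hs) (s.max' hs) := by
  ext n
  rw [Finset.mem_Icc]
  exact ⟨fun h => ⟨s.min'_le n h, s.le_max' n h⟩,
    fun h => by exact_mod_cast hconv.out (s.min'_mem hs) (s.max'_mem hs) h⟩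

/-- The Kusmin–Landau inequality on an order-connected finite set, with the phase increments
between two consecutive integers. -/
lemma norm_sum_le_of_phase_increment {z : ℕ → ℂ} {θ : ℕ → ℝ} {η : ℝ} {s : Finset ℕ} (k : ℤ)
    (hη : 0 < η) (hs : (s : Set ℕ).OrdConnected) (hz : ∀ n, ‖z n‖ ≤ 1)
    (hrec : ∀ n ∈ s, z (n + 1) = z n * Complex.exp (2 * Real.pi * Complex.I * θ n))
    (hmono : MonotoneOn θ s) (hθ : ∀ n ∈ s, k + η ≤ θ n ∧ θ n ≤ k + 1 - η) :
    ‖∑ n ∈ s, z n‖ ≤ 2 / η := by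
  rcases s.eq_empty_or_nonempty with rfl | hne
  · simp only [Finset.sum_empty, norm_zero]
    positivity
  have heq := Finset.eq_Icc_min'_max' hne hs
  have hab : s.min' hne ≤ s.max' hne := s.min'_le _ (s.max'_mem hne)
  generalize s.min' hne = a at heq hab
  generalize s.max' hne = b at heq hab
  subst heq
  refine norm_sum_Icc_le_of_phase_increment (φ := fun n => θ n - k) hη hab hz ?_ ?_ ?_
  · intro n hn
    rw [hrec n hn]
    congr 1
    rw [show (2 * Real.pi * Complex.I * ((θ n - k : ℝ) : ℂ)) =
      2 * Real.pi * Complex.I * θ n - k * (2 * Real.pi * Complex.I) by push_cast; ring,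
      Complex.exp_sub, Complex.exp_int_mul_two_pi_mul_I, div_one]
  · intro m hm n hn hmn
    have := hmono (by simpa using hm) (by simpa using hn) hmn
    simpa using this
  · intro n hn
    have := hθ n hn
    constructor <;> linarith

lemma card_le_of_separated {θ : ℕ → ℝ} {η l u : ℝ} {s : Finset ℕ} (hl : 0 < l) (hη : 0 ≤ η)
    (hsep : ∀ m ∈ s, ∀ n ∈ s, m ≤ n → l * ((n : ℝ) - m) ≤ θ n - θ m)
    (hθ : ∀ n ∈ s, u ≤ θ n ∧ θ n ≤ u + η) : (s.card : ℝ) ≤ η / l + 1 := by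
  rcases s.eq_empty_or_nonempty with rfl | hne
  · simp only [Finset.card_empty, Nat.cast_zero]
    positivity
  have hmin := s.min'_mem hne
  have hmax := s.max'_mem hne
  have hab : s.min' hne ≤ s.max' hne := s.min'_le _ hmax
  have h1 := hsep _ hmin _ hmax hab
  have hcard : s.card ≤ s.max' hne + 1 - s.min' hne := by
    rw [← Nat.card_Icc]
    exact Finset.card_le_card fun n hn => Finset.mem_Icc.2 ⟨s.min'_le n hn, s.le_max' n hn⟩
  have hcard' : (s.card : ℝ) + s.min' hne ≤ s.max' hne + 1 := by
    exact_mod_cast (show s.card + s.min' hne ≤ s.max' hne + 1 by omega)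
  have h2 : ((s.max' hne : ℕ) : ℝ) - (s.min' hne : ℕ) ≤ η / l := by
    rw [le_div_iff₀ hl]
    linarith [(hθ _ hmin).1, (hθ _ hmax).2]
  linarith

/-- **Van der Corput's second derivative test** in discrete form. -/
lemma norm_sum_le_of_separated_phase_increment {z : ℕ → ℂ} {θ : ℕ → ℝ} {η l A B : ℝ}
    {s : Finset ℕ} (hη : 0 < η) (hl : 0 < l) (hAB : A ≤ B) (hs : (s : Set ℕ).OrdConnected)
    (hz : ∀ n, ‖z n‖ ≤ 1)
    (hrec : ∀ n ∈ s, z (n + 1) = z n * Complex.exp (2 * Real.pi * Complex.I * θ n))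
    (hsep : ∀ m ∈ s, ∀ n ∈ s, m ≤ n → l * ((n : ℝ) - m) ≤ θ n - θ m)
    (hθ : ∀ n ∈ s, A ≤ θ n ∧ θ n ≤ B) :
    ‖∑ n ∈ s, z n‖ ≤ (B - A + 2) * (2 / η + 2 * (η / l + 1)) := by
  have hmono : MonotoneOn θ s := by
    intro m hm n hn hmn
    have h1 := hsep m hm n hn hmn
    have h2 : (0 : ℝ) ≤ l * ((n : ℝ) - m) :=
      mul_nonneg hl.le (sub_nonneg.2 (by exact_mod_cast hmn))
    linarith
  have hcard : ∀ t ⊆ s, ∀ u : ℝ, (∀ n ∈ t, u ≤ θ n ∧ θ n ≤ u + η) →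
      ‖∑ n ∈ t, z n‖ ≤ η / l + 1 := by
    intro t hts u hu
    refine le_trans ?_ (card_le_of_separated hl hη.le
      (fun m hm n hn => hsep m (hts hm) n (hts hn)) hu)
    simpa using norm_sum_le_of_le t fun n _ => hz n
  have hblock : ∀ k : ℤ, ‖∑ n ∈ s with ⌊θ n⌋ = k, z n‖ ≤ 2 / η + 2 * (η / l + 1) := by
    intro k
    set r := s.filter fun n => ⌊θ n⌋ = k with hr
    have hrk : ∀ n ∈ r, n ∈ s ∧ (k : ℝ) ≤ θ n ∧ θ n < k + 1 := by
      intro n hn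
      rw [hr, Finset.mem_filter, Int.floor_eq_iff] at hn
      exact hn
    rw [← Finset.sum_filter_add_sum_filter_not r (fun n => θ n < k + η),
      ← Finset.sum_filter_add_sum_filter_not (r.filter fun n => ¬ θ n < k + η)
        (fun n => k + 1 - η < θ n)]
    have h1 : ‖∑ n ∈ r with θ n < k + η, z n‖ ≤ η / l + 1 := by
      refine hcard _ (fun n hn => (hrk n (Finset.mem_filter.1 hn).1).1) k fun n hn => ?_
      rw [Finset.mem_filter] at hn
      exact ⟨(hrk n hn.1).2.1, hn.2.le⟩
    have h2 : ‖∑ n ∈ r.filter (fun n => ¬ θ n < k + η) with k + 1 - η < θ n, z n‖ ≤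
        η / l + 1 := by
      refine hcard _ (fun n hn => (hrk n ?_).1) (k + 1 - η) fun n hn => ?_
      · exact (Finset.mem_filter.1 (Finset.mem_filter.1 hn).1).1
      · rw [Finset.mem_filter, Finset.mem_filter] at hn
        have := hrk n hn.1.1
        exact ⟨hn.2.le, by linarith⟩
    have h3 : ‖∑ n ∈ r.filter (fun n => ¬ θ n < k + η) with ¬ k + 1 - η < θ n, z n‖ ≤
        2 / η := by
      set q := (r.filter (fun n => ¬ θ n < k + η)).filter fun n => ¬ k + 1 - η < θ n with hq
      have hqs : ∀ n, n ∈ q ↔ n ∈ s ∧ k + η ≤ θ n ∧ θ n ≤ k + 1 - η := by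
        intro n
        simp only [hq, hr, Finset.mem_filter, not_lt, Int.floor_eq_iff]
        constructor
        · rintro ⟨⟨⟨h1, -⟩, h2⟩, h3⟩
          exact ⟨h1, h2, h3⟩
        · rintro ⟨h1, h2, h3⟩
          exact ⟨⟨⟨h1, by linarith, by linarith⟩, h2⟩, h3⟩
      have hqsub : (q : Set ℕ) ⊆ s := fun n hn => ((hqs n).1 hn).1
      refine norm_sum_le_of_phase_increment k hη ⟨?_⟩ hz
        (fun n hn => hrec n (hqsub hn)) (hmono.mono hqsub) (fun n hn => ((hqs n).1 hn).2)
      intro m hm n hn x hx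
      have hxs : x ∈ (s : Set ℕ) := hs.out (hqsub hm) (hqsub hn) hx
      refine (hqs x).2 ⟨hxs, ?_, ?_⟩
      · exact ((hqs m).1 hm).2.1.trans (hmono (hqsub hm) hxs hx.1)
      · exact (hmono hxs (hqsub hn) hx.2).trans ((hqs n).1 hn).2.2
    refine (norm_add_le _ _).trans ?_
    refine (add_le_add h1 ((norm_add_le _ _).trans (add_le_add h2 h3))).trans ?_
    linarith
  have hmaps : ∀ n ∈ s, ⌊θ n⌋ ∈ Finset.Icc ⌊A⌋ ⌊B⌋ := fun n hn =>
    Finset.mem_Icc.2 ⟨Int.floor_le_floor (hθ n hn).1, Int.floor_le_floor (hθ n hn).2⟩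
  rw [← Finset.sum_fiberwise_of_maps_to hmaps]
  refine (norm_sum_le_of_le _ fun k _ => hblock k).trans ?_
  rw [Finset.sum_const, nsmul_eq_mul]
  refine mul_le_mul_of_nonneg_right ?_ (by positivity)
  have hfl : ⌊A⌋ ≤ ⌊B⌋ := Int.floor_le_floor hAB
  have hc : ((Finset.Icc ⌊A⌋ ⌊B⌋).card : ℤ) = ⌊B⌋ + 1 - ⌊A⌋ := by
    rw [Int.card_Icc]
    omega
  have hc' : ((Finset.Icc ⌊A⌋ ⌊B⌋).card : ℝ) = ⌊B⌋ + 1 - ⌊A⌋ := by exact_mod_cast hc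
  rw [hc']
  linarith [Int.floor_le B, Int.lt_floor_add_one A]

lemma norm_natCast_cpow_neg_two_pi_I_mul (y : ℝ) (n : ℕ) (hn : n ≠ 0) :
    ‖(n : ℂ) ^ (-(2 * (Real.pi : ℂ) * Complex.I * (y : ℂ)))‖ = 1 := by
  rw [Complex.norm_natCast_cpow_of_pos (Nat.pos_of_ne_zero hn)]
  simp

lemma Gpoly_eq_sum_Ioc (δ' y : ℝ) {D : ℝ} (hD : 0 ≤ D) (hδ' : 0 ≤ δ') :
    Gpoly δ' y D = ∑ n ∈ Finset.Ioc ⌊D⌋₊ ⌊D * (1 + δ')⌋₊,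
      (n : ℂ) ^ (-(2 * (Real.pi : ℂ) * Complex.I * (y : ℂ))) := by
  have hD' : 0 ≤ D * (1 + δ') := by positivity
  unfold Gpoly
  rw [← Function.Injective.tsum_eq (g := ((↑) : ℕ → ℤ)) Nat.cast_injective]
  · rw [tsum_eq_sum (s := Finset.Ioc ⌊D⌋₊ ⌊D * (1 + δ')⌋₊)]
    · refine Finset.sum_congr rfl fun n hn => ?_
      rw [Finset.mem_Ioc, Nat.floor_lt hD, Nat.le_floor_iff hD'] at hn
      rw [if_pos (by exact_mod_cast hn)]
      norm_cast
    · intro n hn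
      rw [Finset.mem_Ioc, Nat.floor_lt hD, Nat.le_floor_iff hD'] at hn
      rw [if_neg (by exact_mod_cast hn)]
  · intro t ht
    have h : D < (t : ℝ) := by
      by_contra h
      exact ht (if_neg fun h' => h h'.1)
    have h0 : 0 ≤ t := by exact_mod_cast (hD.trans h.le)
    exact ⟨t.toNat, Int.toNat_of_nonneg h0⟩

lemma norm_Gpoly_neg (δ' y : ℝ) {D : ℝ} (hD : 0 ≤ D) (hδ' : 0 ≤ δ') :
    ‖Gpoly δ' (-y) D‖ = ‖Gpoly δ' y D‖ := by
  rw [Gpoly_eq_sum_Ioc δ' _ hD hδ', Gpoly_eq_sum_Ioc δ' _ hD hδ', ← Complex.norm_conj, map_sum]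
  congr 1
  refine Finset.sum_congr rfl fun n _ => ?_
  have h := Complex.cpow_conj (n : ℂ) (-(2 * (Real.pi : ℂ) * Complex.I * ((-y : ℝ) : ℂ)))
    (by rw [Complex.natCast_arg]; exact Real.pi_pos.ne)
  rw [Complex.conj_natCast] at h
  rw [← h]
  simp [Complex.conj_ofNat]

/-- The increments of the phase `-y log n` of `n ^ (-2πiy)`. -/
lemma cpow_succ_eq_mul_exp (y : ℝ) {n : ℕ} (hn : n ≠ 0) :
    ((n + 1 : ℕ) : ℂ) ^ (-(2 * (Real.pi : ℂ) * Complex.I * (y : ℂ))) =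
      (n : ℂ) ^ (-(2 * (Real.pi : ℂ) * Complex.I * (y : ℂ))) *
        Complex.exp (2 * Real.pi * Complex.I *
          (-y * (Real.log ((n : ℝ) + 1) - Real.log n) : ℝ)) := by
  rw [Complex.cpow_def_of_ne_zero (by exact_mod_cast n.succ_ne_zero),
    Complex.cpow_def_of_ne_zero (by exact_mod_cast hn), ← Complex.exp_add,
    ← Complex.natCast_log, ← Complex.natCast_log]
  congr 1
  push_cast
  ring

lemma log_add_one_sub_log_bounds {x : ℝ} (hx : 0 < x) :
    1 / (x + 1) ≤ Real.log (x + 1) - Real.log x ∧ Real.log (x + 1) - Real.log x ≤ 1 / x := by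
  rw [← Real.log_div (by positivity) (by positivity)]
  constructor
  · refine le_trans (le_of_eq ?_) (Real.one_sub_inv_le_log_of_pos (by positivity))
    field_simp
    ring
  · refine (Real.log_le_sub_one_of_pos (by positivity)).trans (le_of_eq ?_)
    field_simp
    ring

lemma div_le_log_increment_sub {m n : ℝ} (hm : 0 < m) (hn : 0 < n) :
    (n - m) / ((m + 1) * n) ≤
      (Real.log (m + 1) - Real.log m) - (Real.log (n + 1) - Real.log n) := by
  have h : (Real.log (m + 1) - Real.log m) - (Real.log (n + 1) - Real.log n) =
      Real.log ((m + 1) * n / (m * (n + 1))) := by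
    rw [Real.log_div (by positivity) (by positivity), Real.log_mul (by positivity) (by positivity),
      Real.log_mul (by positivity) (by positivity)]
    ring
  rw [h]
  refine le_trans (le_of_eq ?_) (Real.one_sub_inv_le_log_of_pos (by positivity))
  field_simp
  ring

lemma norm_Gpoly_le_two_mul {δ' D : ℝ} (y : ℝ) (hδ'0 : 0 ≤ δ') (hδ' : δ' ≤ 1) (hD : 1 ≤ D) :
    ‖Gpoly δ' y D‖ ≤ 2 * D := by
  rw [Gpoly_eq_sum_Ioc δ' y (by linarith) hδ'0]
  have h : ∀ n ∈ Finset.Ioc ⌊D⌋₊ ⌊D * (1 + δ')⌋₊,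
      ‖(n : ℂ) ^ (-(2 * (Real.pi : ℂ) * Complex.I * (y : ℂ)))‖ ≤ 1 := fun n hn =>
    (norm_natCast_cpow_neg_two_pi_I_mul y n (by rw [Finset.mem_Ioc] at hn; omega)).le
  refine (norm_sum_le_of_le _ h).trans ?_
  rw [Finset.sum_const, Nat.card_Ioc, nsmul_eq_mul, mul_one]
  calc ((⌊D * (1 + δ')⌋₊ - ⌊D⌋₊ : ℕ) : ℝ) ≤ (⌊D * (1 + δ')⌋₊ : ℝ) := by
        exact_mod_cast Nat.sub_le _ _
    _ ≤ D * (1 + δ') := Nat.floor_le (by positivity)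
    _ ≤ 2 * D := by nlinarith

/-- For `y > 0`: the bound by the first or by the second derivative test, according to the size
of `y` compared to `D`. -/
lemma norm_Gpoly_le_of_pos {δ' D y : ℝ} (hδ'0 : 0 ≤ δ') (hδ' : δ' ≤ 1) (hD : 1 ≤ D)
    (hy : 0 < y) :
    (y ≤ D / 2 → ‖Gpoly δ' y D‖ ≤ 6 * (D / y)) ∧
      (D / 2 ≤ y → y ≤ D ^ 2 → ‖Gpoly δ' y D‖ ≤ 60 * √y) := by
  have hD0 : 0 < D := by linarith
  rw [Gpoly_eq_sum_Ioc δ' y hD0.le hδ'0]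
  set s := Finset.Ioc ⌊D⌋₊ ⌊D * (1 + δ')⌋₊ with hs
  set z : ℕ → ℂ := fun n => (n : ℂ) ^ (-(2 * (Real.pi : ℂ) * Complex.I * (y : ℂ))) with hz
  set θ : ℕ → ℝ := fun n => -y * (Real.log ((n : ℝ) + 1) - Real.log n) with hθ
  have hmem : ∀ n ∈ s, D < n ∧ (n : ℝ) ≤ 2 * D := by
    intro n hn
    rw [hs, Finset.mem_Ioc, Nat.floor_lt hD0.le, Nat.le_floor_iff (by positivity)] at hn
    exact ⟨hn.1, hn.2.trans (by nlinarith)⟩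
  have hconv : (s : Set ℕ).OrdConnected := by
    rw [hs, Finset.coe_Ioc]
    exact Set.ordConnected_Ioc
  have hz1 : ∀ n, ‖z n‖ ≤ 1 := by
    intro n
    rcases eq_or_ne n 0 with rfl | hn
    · simp only [hz, Nat.cast_zero]
      rw [Complex.zero_cpow (by simp [Real.pi_ne_zero, hy.ne'])]
      simp
    · exact (norm_natCast_cpow_neg_two_pi_I_mul y n hn).le
  have hrec : ∀ n ∈ s, z (n + 1) = z n * Complex.exp (2 * Real.pi * Complex.I * θ n) :=
    fun n hn => cpow_succ_eq_mul_exp y (by rw [hs, Finset.mem_Ioc] at hn; omega)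
  have hl : 0 < y / (6 * D ^ 2) := by positivity
  have hsep : ∀ m ∈ s, ∀ n ∈ s, m ≤ n → y / (6 * D ^ 2) * ((n : ℝ) - m) ≤ θ n - θ m := by
    intro m hm n hn hmn
    obtain ⟨hm1, hm2⟩ := hmem m hm
    obtain ⟨hn1, hn2⟩ := hmem n hn
    have hm0 : (0 : ℝ) < m := hD0.trans hm1
    have hn0 : (0 : ℝ) < n := hD0.trans hn1
    have hmn' : (0 : ℝ) ≤ (n : ℝ) - m := sub_nonneg.2 (by exact_mod_cast hmn)
    have h1 := mul_le_mul_of_nonneg_left (div_le_log_increment_sub hm0 hn0) hy.le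
    have h2 : ((n : ℝ) - m) / (6 * D ^ 2) ≤ ((n : ℝ) - m) / (((m : ℝ) + 1) * n) := by
      refine div_le_div_of_nonneg_left hmn' (by positivity) ?_
      nlinarith
    have h3 := mul_le_mul_of_nonneg_left h2 hy.le
    calc y / (6 * D ^ 2) * ((n : ℝ) - m) = y * (((n : ℝ) - m) / (6 * D ^ 2)) := by ring
      _ ≤ _ := h3.trans h1
      _ = θ n - θ m := by simp only [hθ]; ring
  have hmono : MonotoneOn θ s := by
    intro m hm n hn hmn
    have h1 := hsep m hm n hn hmn
    have h2 := mul_nonneg hl.le (sub_nonneg.2 (show (m : ℝ) ≤ n by exact_mod_cast hmn))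
    linarith
  have hrange : ∀ n ∈ s, -(y / D) ≤ θ n ∧ θ n ≤ -(y / (3 * D)) := by
    intro n hn
    obtain ⟨hn1, hn2⟩ := hmem n hn
    obtain ⟨h1, h2⟩ := log_add_one_sub_log_bounds (hD0.trans hn1)
    have h3 : 1 / (n : ℝ) ≤ 1 / D := one_div_le_one_div_of_le hD0 hn1.le
    have h4 : 1 / (3 * D) ≤ 1 / ((n : ℝ) + 1) :=
      one_div_le_one_div_of_le (by positivity) (by linarith)
    have h5 := mul_le_mul_of_nonneg_left (h2.trans h3) hy.le
    have h6 := mul_le_mul_of_nonneg_left (h4.trans h1) hy.le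
    rw [mul_one_div] at h5 h6
    simp only [hθ]
    constructor <;> linarith
  constructor
  · intro hyD
    have hη : 0 < y / (3 * D) := by positivity
    have h := norm_sum_le_of_phase_increment (η := y / (3 * D)) (-1) hη hconv hz1 hrec hmono ?_
    · refine h.trans (le_of_eq ?_)
      field_simp
      norm_num
    · intro n hn
      have h1 := hrange n hn
      have h2 : y / D ≤ 1 / 2 := by
        rw [div_le_iff₀ hD0]
        linarith
      have h3 : y / (3 * D) = y / D / 3 := by field_simp
      push_cast
      constructor <;> linarith
  · intro hyD hyD2
    obtain ⟨w, hw0, hw⟩ : ∃ w : ℝ, 0 < w ∧ y = w ^ 2 :=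
      ⟨√y, Real.sqrt_pos.2 hy, (Real.sq_sqrt hy.le).symm⟩
    have hsqrt : √y = w := by rw [hw, Real.sqrt_sq hw0.le]
    have hwD : w ≤ D := by
      rw [hw] at hyD2
      exact (sq_le_sq₀ hw0.le hD0.le).1 hyD2
    have h := norm_sum_le_of_separated_phase_increment (η := w / (2 * D)) (A := -(y / D)) (B := 0)
      (by positivity) hl (by simp only [Left.neg_nonpos_iff]; positivity) hconv hz1 hrec hsep
      fun n hn => ⟨(hrange n hn).1, (hrange n hn).2.trans (by
        simp only [Left.neg_nonpos_iff]; positivity)⟩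
    refine h.trans ?_
    rw [hsqrt]
    have h1 : 0 - -(y / D) + 2 ≤ 5 * (y / D) := by
      have : 1 / 2 ≤ y / D := by
        rw [le_div_iff₀ hD0]
        linarith
      linarith
    have h2 : 2 / (w / (2 * D)) + 2 * (w / (2 * D) / (y / (6 * D ^ 2)) + 1) ≤ 12 * (D / w) := by
      have h3 : 1 ≤ D / w := by
        rw [le_div_iff₀ hw0]
        linarith
      have h4 : 2 / (w / (2 * D)) = 4 * (D / w) := by
        field_simp
        norm_num
      have h5 : w / (2 * D) / (y / (6 * D ^ 2)) = 3 * (D / w) := by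
        rw [hw]
        field_simp
        norm_num
      rw [h4, h5]
      linarith
    refine (mul_le_mul h1 h2 (by positivity) (by positivity)).trans (le_of_eq ?_)
    rw [hw]
    field_simp
    norm_num

lemma norm_Gpoly_le {δ' D : ℝ} (y : ℝ) (hδ'0 : 0 ≤ δ') (hδ' : δ' ≤ 1) (hD : 1 ≤ D) :
    ‖Gpoly δ' y D‖ ≤ 60 * (D / (1 + |y|) + D ^ (1 / 2 : ℝ) * |y| ^ (1 / 4 : ℝ)) := by
  have hD0 : 0 < D := by linarith
  wlog hy : 0 ≤ y generalizing y
  · rw [← abs_neg, ← norm_Gpoly_neg δ' y hD0.le hδ'0]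
    exact this (-y) (by linarith)
  rw [abs_of_nonneg hy]
  have hP : 0 ≤ D / (1 + y) := by positivity
  have hQ : 0 ≤ D ^ (1 / 2 : ℝ) * y ^ (1 / 4 : ℝ) := by positivity
  rcases le_or_gt y 1 with h1 | h1
  · have h2 : D ≤ 2 * (D / (1 + y)) := by
      rw [← mul_div_assoc, le_div_iff₀ (by linarith)]
      nlinarith
    linarith [norm_Gpoly_le_two_mul y hδ'0 hδ' hD]
  have hy0 : 0 < y := by linarith
  obtain ⟨hsmall, hmid⟩ := norm_Gpoly_le_of_pos hδ'0 hδ' hD hy0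
  rcases le_total y (D / 2) with h2 | h2
  · have h3 : D / y ≤ 2 * (D / (1 + y)) := by
      rw [← mul_div_assoc, div_le_div_iff₀ hy0 (by linarith)]
      nlinarith
    linarith [hsmall h2]
  have hDpow : (D ^ 2) ^ (1 / 4 : ℝ) = D ^ (1 / 2 : ℝ) := by
    rw [← Real.rpow_natCast_mul hD0.le]
    norm_num
  rcases le_total y (D ^ 2) with h3 | h3
  · have h4 : √y = y ^ (1 / 4 : ℝ) * y ^ (1 / 4 : ℝ) := by
      rw [← Real.rpow_add hy0, Real.sqrt_eq_rpow]
      norm_num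
    have h5 : y ^ (1 / 4 : ℝ) ≤ D ^ (1 / 2 : ℝ) := by
      rw [← hDpow]
      exact Real.rpow_le_rpow hy h3 (by norm_num)
    have h6 : √y ≤ D ^ (1 / 2 : ℝ) * y ^ (1 / 4 : ℝ) := by
      rw [h4]
      exact mul_le_mul_of_nonneg_right h5 (by positivity)
    linarith [hmid h2 h3]
  · have h4 : D ^ (1 / 2 : ℝ) ≤ y ^ (1 / 4 : ℝ) := by
      rw [← hDpow]
      exact Real.rpow_le_rpow (by positivity) h3 (by norm_num)
    have h5 : D = D ^ (1 / 2 : ℝ) * D ^ (1 / 2 : ℝ) := by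
      rw [← Real.rpow_add hD0]
      norm_num
    have h6 : D ≤ D ^ (1 / 2 : ℝ) * y ^ (1 / 4 : ℝ) :=
      h5.le.trans (mul_le_mul_of_nonneg_left h4 (by positivity))
    linarith [norm_Gpoly_le_two_mul y hδ'0 hδ' hD]

/-- **Convexity bound for `G(y, D)`.** Via Perron's formula and the convexity bound for
the Riemann zeta function: for every `ε > 0` and every parameter `T > 1`,
`G(y, D) ≪_{ε,δ'} (D log D)/T (T+|y|)^ε + D/(1+|y|) + D^{1/2}(T+|y|)^{1/4+ε}`. -/
theorem Gpoly_bound (δ' ε : ℝ) (hδ'0 : 0 < δ') (hδ' : δ' < 1) (hε : 0 < ε) :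
    ∃ C : ℝ, 0 < C ∧ ∀ D y T : ℝ, 2 ≤ D → 1 < T →
      ‖Gpoly δ' y D‖ ≤
        C * (D * Real.log D / T * (T + |y|) ^ ε + D / (1 + |y|) +
          D ^ ((1 : ℝ) / 2) * (T + |y|) ^ (1 / 4 + ε)) := by
  refine ⟨60, by norm_num, fun D y T hD hT => ?_⟩
  refine (norm_Gpoly_le y hδ'0.le hδ'.le (by linarith)).trans ?_
  have hlog : 0 ≤ Real.log D := Real.log_nonneg (by linarith)
  have hTy : 1 ≤ T + |y| := by linarith [abs_nonneg y]
  have h1 : 0 ≤ D * Real.log D / T * (T + |y|) ^ ε := by positivity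
  have h2 : |y| ^ (1 / 4 : ℝ) ≤ (T + |y|) ^ (1 / 4 + ε) :=
    (Real.rpow_le_rpow (abs_nonneg y) (by linarith) (by norm_num)).trans
      (Real.rpow_le_rpow_of_exponent_le hTy (by linarith))
  have h3 := mul_le_mul_of_nonneg_left h2 (show 0 ≤ D ^ (1 / 2 : ℝ) by positivity)
  linarith
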